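/- Let H be a metric space and let Q be the set of continuous functions q : [0,∞) → H. Let D ⊆ H and let U assign to each x ∈ D a set U(x) ⊆ Q such that: (compatibility) q(0) = x and q(t) ∈ D for all q ∈ U(x) and t ≥ 0; (shift invariance) for every x ∈ D, q ∈ U(x) and T ≥ 0, the shifted trajectory S_T ∘ q belongs to U(q(T)); (continuation) for every x ∈ D, q₁ ∈ U(x), T ≥ 0 and q₂ ∈ U(q₁(T)), the glued trajectory q₁ ∪_T q₂ belongs to U(x). Let λ > 0 and let F : H → ℝ be bounded and continuous, and set I(q) = ∫₀^∞ e^{-λt} F(q(t)) dt. Fix T ≥ 0 and x ∈ D. If q₁ ∈ U(x) satisfies I(q₁) ≤ I(q̃) for all q̃ ∈ U(x), and q₂ ∈ U(q₁(T)) satisfies I(q₂) ≤ I(q') for all q' ∈ U(q₁(T)), then the glued trajectory q₁ ∪_T q₂ satisfies I(q₁ ∪_T q₂) ≤ I(q̃) for all q̃ ∈ U(x). -/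

import Mathlib

open Set Filter MeasureTheory

/-- The time shift operator: `(S_T ∘ q)(t) = q(T + t)`. -/
def shiftTraj {H : Type*} (T : ℝ) (q : ℝ → H) : ℝ → H := fun t => q (T + t)

/-- The continuation operator: `(q₁ ∪_T q₂)(t) = q₁(t)` for `0 ≤ t ≤ T` and
`(q₁ ∪_T q₂)(t) = q₂(t − T)` for `t > T`. -/
noncomputable def glueTraj {H : Type*} (T : ℝ) (q₁ q₂ : ℝ → H) : ℝ → H :=
  fun t => if t ≤ T then q₁ t else q₂ (t - T)

/-- The functional `I_{λ,F}(q) = ∫₀^∞ e^{-λt} F(q(t)) dt`. -/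
noncomputable def Ifun {H : Type*} (lam : ℝ) (F : H → ℝ) (q : ℝ → H) : ℝ :=
  ∫ t in Ioi (0 : ℝ), Real.exp (-lam * t) * F (q t)

theorem Ifun_integrable {H : Type*} [MetricSpace H] (lam : ℝ) (hlam : 0 < lam)
    (F : H → ℝ) (hFc : Continuous F) (hFb : ∃ C, ∀ y, |F y| ≤ C)
    (q : ℝ → H) (hq : ContinuousOn q (Ici 0)) :
    IntegrableOn (fun t => Real.exp (-lam * t) * F (q t)) (Ioi (0 : ℝ)) := by
  obtain ⟨C, hC⟩ := hFb
  have h1 : IntegrableOn (fun t => Real.exp (-lam * t)) (Ioi (0 : ℝ)) :=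
    integrableOn_exp_mul_Ioi (by linarith) 0
  refine Integrable.mul_bdd (c := C) h1 ?_ ?_
  · exact ((hFc.comp_continuousOn hq).mono Ioi_subset_Ici_self).aestronglyMeasurable
      measurableSet_Ioi
  · exact Eventually.of_forall fun t => hC _

theorem Ifun_split {H : Type*} [MetricSpace H] (lam : ℝ) (hlam : 0 < lam)
    (F : H → ℝ) (hFc : Continuous F) (hFb : ∃ C, ∀ y, |F y| ≤ C)
    (q : ℝ → H) (hq : ContinuousOn q (Ici 0)) (T : ℝ) (hT : 0 ≤ T) :
    Ifun lam F q = (∫ t in Ioc 0 T, Real.exp (-lam * t) * F (q t))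
      + Real.exp (-lam * T) * Ifun lam F (shiftTraj T q) := by
  have hi := Ifun_integrable lam hlam F hFc hFb q hq
  unfold Ifun
  rw [← Ioc_union_Ioi_eq_Ioi hT, setIntegral_union (Ioc_disjoint_Ioi le_rfl) measurableSet_Ioi
    (hi.mono_set Ioc_subset_Ioi_self) (hi.mono_set (Ioi_subset_Ioi hT)),
    Ioc_union_Ioi_eq_Ioi hT]
  congr 1
  rw [← integral_const_mul]
  have h := (measurePreserving_add_left (volume : Measure ℝ) T).setIntegral_preimage_emb
    (measurableEmbedding_addLeft T) (fun t => Real.exp (-lam * t) * F (q t)) (Ioi T)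
  rw [← h]
  have hp : (fun x => T + x) ⁻¹' Ioi T = Ioi (0 : ℝ) := by
    ext t; simp
  rw [hp]
  refine setIntegral_congr_fun measurableSet_Ioi fun t _ => ?_
  simp only [shiftTraj]
  rw [← mul_assoc, ← Real.exp_add]
  ring_nf

/-- (P5), abstract form: gluing at time `T` a minimizer `q₁` of `I_{λ,F}` over
`U(x)` with a minimizer `q₂` of `I_{λ,F}` over `U(q₁(T))` produces a minimizer
of `I_{λ,F}` over `U(x)`. -/
theorem glue_of_minimizers_is_minimizer
    {H : Type*} [MetricSpace H] (D : Set H) (U : H → Set (ℝ → H))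
    (hQ : ∀ x ∈ D, ∀ q ∈ U x, ContinuousOn q (Ici 0))
    (hcompat : ∀ x ∈ D, ∀ q ∈ U x, q 0 = x ∧ ∀ t ≥ (0 : ℝ), q t ∈ D)
    (hshift : ∀ x ∈ D, ∀ q ∈ U x, ∀ T ≥ (0 : ℝ), shiftTraj T q ∈ U (q T))
    (hglue : ∀ x ∈ D, ∀ q₁ ∈ U x, ∀ T ≥ (0 : ℝ), ∀ q₂ ∈ U (q₁ T),
      glueTraj T q₁ q₂ ∈ U x)
    (lam : ℝ) (hlam : 0 < lam)
    (F : H → ℝ) (hFc : Continuous F) (hFb : ∃ C, ∀ y, |F y| ≤ C)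
    (T : ℝ) (hT : 0 ≤ T) (x : H) (hx : x ∈ D)
    (q₁ : ℝ → H) (hq₁ : q₁ ∈ U x)
    (hmin₁ : ∀ q' ∈ U x, Ifun lam F q₁ ≤ Ifun lam F q')
    (q₂ : ℝ → H) (hq₂ : q₂ ∈ U (q₁ T))
    (hmin₂ : ∀ q' ∈ U (q₁ T), Ifun lam F q₂ ≤ Ifun lam F q') :
    ∀ q' ∈ U x, Ifun lam F (glueTraj T q₁ q₂) ≤ Ifun lam F q' := by
  intro q' hq'
  refine le_trans ?_ (hmin₁ q' hq')
  have hg := hglue x hx q₁ hq₁ T hT q₂ hq₂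
  rw [Ifun_split lam hlam F hFc hFb _ (hQ x hx _ hg) T hT,
    Ifun_split lam hlam F hFc hFb q₁ (hQ x hx _ hq₁) T hT]
  have e1 : (∫ t in Ioc 0 T, Real.exp (-lam * t) * F (glueTraj T q₁ q₂ t))
      = ∫ t in Ioc 0 T, Real.exp (-lam * t) * F (q₁ t) := by
    refine setIntegral_congr_fun measurableSet_Ioc fun t ht => ?_
    simp [glueTraj, ht.2]
  have e2 : Ifun lam F (shiftTraj T (glueTraj T q₁ q₂)) = Ifun lam F q₂ := by
    refine setIntegral_congr_fun measurableSet_Ioi fun t ht => ?_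
    have ht' : ¬ t ≤ 0 := not_le.mpr ht
    simp [glueTraj, shiftTraj, ht']
  rw [e1, e2]
  have := hmin₂ _ (hshift x hx q₁ hq₁ T hT)
  gcongr
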